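/- For every family B : A → Type (with A a small type), the hereditarily small sets relative to B form a set: there exists a ZF set H such that for every ZF set x, x ∈ H if and only if x is hereditarily small relative to B. -/

import Mathlib

universe u

/-- A ZF set `x` is hereditarily small relative to the family `B : A → Type u`
if `x` is small relative to `B` (some `f : B a → ZFSet` enumerates exactly the
elements of `x`) and every element of `x` is hereditarily small relative to
`B`.  (Since `∈` is well founded on `ZFSet`, this inductive predicate is
exactly the predicate defined by `∈`-recursion.) -/
inductive HereditarilySmall {A : Type u} (B : A → Type u) : ZFSet.{u} → Prop
  | intro (x : ZFSet.{u})
      (small : ∃ (a : A) (f : B a → ZFSet.{u}), ∀ y, y ∈ x ↔ ∃ b, f b = y)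
      (hered : ∀ y ∈ x, HereditarilySmall B y) : HereditarilySmall B x

/-- The ZF set coded by a well-founded tree: its elements are the sets coded by the immediate
subtrees. -/
noncomputable def WType.toZFSet {A : Type u} {B : A → Type u} : WType B → ZFSet.{u}
  | ⟨_, f⟩ => ZFSet.range fun b => (f b).toZFSet

theorem WType.hereditarilySmall_toZFSet {A : Type u} {B : A → Type u} (t : WType B) :
    HereditarilySmall B t.toZFSet := by
  induction t with
  | mk a f ih =>
    have mem (y : ZFSet.{u}) : y ∈ (WType.mk a f).toZFSet ↔ ∃ b, (f b).toZFSet = y := by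
      rw [WType.toZFSet, ZFSet.mem_range]
    refine .intro _ ⟨a, _, mem⟩ fun y hy => ?_
    obtain ⟨b, rfl⟩ := (mem y).1 hy
    exact ih b

theorem HereditarilySmall.exists_toZFSet_eq {A : Type u} {B : A → Type u} {x : ZFSet.{u}}
    (hx : HereditarilySmall B x) : ∃ t : WType B, t.toZFSet = x := by
  induction hx with
  | intro x small _ ih =>
    obtain ⟨a, f, hf⟩ := small
    choose t ht using fun b => ih (f b) ((hf _).2 ⟨b, rfl⟩)
    refine ⟨⟨a, t⟩, ZFSet.ext fun y => ?_⟩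
    rw [WType.toZFSet, ZFSet.mem_range, hf]
    simp only [ht]

/-- The hereditarily small sets relative to a family `B : A → Type u` (with
`A` a small type) form a set: some ZF set `H` has as elements exactly the
hereditarily small sets. -/
theorem hereditarilySmall_is_set (A : Type u) (B : A → Type u) :
    ∃ H : ZFSet.{u}, ∀ x : ZFSet.{u}, x ∈ H ↔ HereditarilySmall B x := by
  refine ⟨ZFSet.range (WType.toZFSet (B := B)), fun x => ?_⟩
  rw [ZFSet.mem_range]
  refine ⟨?_, HereditarilySmall.exists_toZFSet_eq⟩
  rintro ⟨t, rfl⟩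
  exact t.hereditarilySmall_toZFSet
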